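/- The metric space (𝔑, d̄₁) is complete: every d̄₁-Cauchy sequence in 𝔑 converges in d̄₁ to an element of 𝔑. -/

import Mathlib

open scoped BigOperators

/-- The minimal total `d`-cost of matching the points of `ξ` with points of `η`
(only `min(|ξ|,|η|)` points are matched, namely the initial segments of two
suitably ordered lists representing the two point measures). -/
noncomputable def matchCost {S : Type*} (d : S → S → ℝ) (ξ η : Multiset S) : ℝ :=
  sInf {c : ℝ | ∃ xs ys : List S, (xs : Multiset S) = ξ ∧ (ys : Multiset S) = η ∧
    c = (List.zipWith d xs ys).sum}

open scoped Classical in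
/-- The metric `d̄₁` between finite point measures: for `|ξ| = m ≤ n = |η|`, `n ≥ 1`,
`d̄₁(ξ,η) = (1/n) (min_π Σ_{i=1}^m d(x_i, y_{π(i)}) + (n - m))`, and `d̄₁(0,0) = 0`. -/
noncomputable def dbar1 {S : Type*} (d : S → S → ℝ) (ξ η : Multiset S) : ℝ :=
  if ξ = 0 ∧ η = 0 then 0
  else (matchCost d ξ η + (((max ξ.card η.card : ℕ) : ℝ) - ((min ξ.card η.card : ℕ) : ℝ)))
        / ((max ξ.card η.card : ℕ) : ℝ)

open Filter

theorem List.sum_zipWith_nonneg {α β : Type*} {d : α → β → ℝ} (hd : ∀ x y, 0 ≤ d x y)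
    (xs : List α) (ys : List β) : 0 ≤ (List.zipWith d xs ys).sum := by
  apply List.sum_nonneg
  intro c hc
  rw [← List.map_uncurry_zip_eq_zipWith] at hc
  obtain ⟨p, -, rfl⟩ := List.mem_map.1 hc
  exact hd _ _

theorem matchCost_nonneg {S : Type*} {d : S → S → ℝ} (hd : ∀ x y, 0 ≤ d x y)
    (ξ η : Multiset S) : 0 ≤ matchCost d ξ η := by
  apply Real.sInf_nonneg
  rintro c ⟨xs, ys, -, -, rfl⟩
  exact List.sum_zipWith_nonneg hd xs ys

theorem List.zipWith_ofFn {α β γ : Type*} {n : ℕ} (d : α → β → γ) (f : Fin n → α)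
    (g : Fin n → β) :
    List.zipWith d (List.ofFn f) (List.ofFn g) = List.ofFn fun i => d (f i) (g i) := by
  apply List.ext_getElem <;> simp

/-- Any pairing of the points of two point measures bounds the matching cost from above. -/
theorem matchCost_ofFn_le {S : Type*} {d : S → S → ℝ} (hd : ∀ x y, 0 ≤ d x y) {n : ℕ}
    (f g : Fin n → S) :
    matchCost d (List.ofFn f : Multiset S) (List.ofFn g : Multiset S) ≤ ∑ i, d (f i) (g i) := by
  refine csInf_le ⟨0, ?_⟩ ⟨_, _, rfl, rfl, by rw [List.zipWith_ofFn, List.sum_ofFn]⟩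
  rintro c ⟨xs, ys, -, -, rfl⟩
  exact List.sum_zipWith_nonneg hd xs ys

/-- A near-optimal matching can be realised relative to a prescribed enumeration of the second
point measure. -/
theorem exists_sum_lt_of_matchCost_lt {S : Type*} {d : S → S → ℝ} {n : ℕ} {ξ : Multiset S}
    (hξ : ξ.card = n) (g : Fin n → S) {c : ℝ}
    (h : matchCost d ξ (List.ofFn g : Multiset S) < c) :
    ∃ f : Fin n → S, (List.ofFn f : Multiset S) = ξ ∧ ∑ i, d (f i) (g i) < c := by
  have hne : {c : ℝ | ∃ xs ys : List S, (xs : Multiset S) = ξ ∧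
      (ys : Multiset S) = (List.ofFn g : Multiset S) ∧
      c = (List.zipWith d xs ys).sum}.Nonempty :=
    ⟨_, ξ.toList, _, ξ.coe_toList, rfl, rfl⟩
  obtain ⟨_, ⟨xs, ys, rfl, hys, rfl⟩, hc⟩ := exists_lt_of_csInf_lt hne h
  rw [Multiset.coe_card] at hξ
  have hperm := Multiset.coe_eq_coe.1 hys
  have hlen : ys.length = n := by simpa using hperm.length_eq
  have hsnd : (List.ofFn g).Perm (List.map Prod.snd (xs.zip ys)) := by
    rw [List.map_snd_zip (by omega)]
    exact hperm.symm
  obtain ⟨z, hz, hzp⟩ :=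
    (congrFun₂ (List.eq_map_comp_perm Prod.snd) (List.ofFn g) (xs.zip ys)).mpr hsnd
  have hzl : z.length = n := by simpa using (congrArg List.length hz).symm
  subst hzl
  refine ⟨fun i => (z.get i).1, ?_, ?_⟩
  · have : List.ofFn (fun i => (z.get i).1) = z.map Prod.fst := by
      apply List.ext_getElem <;> simp
    rw [this, Multiset.coe_eq_coe]
    refine (hzp.map Prod.fst).trans ?_
    rw [List.map_fst_zip (by omega)]
  · refine lt_of_eq_of_lt ?_ hc
    have hg : ∀ i, g i = (z.get i).2 := fun i => by
      have := List.getElem_of_eq hz (i := i) (by simp)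
      simpa using this
    rw [← List.map_uncurry_zip_eq_zipWith, ← (hzp.map _).sum_eq, ← List.sum_ofFn]
    congr 1
    apply List.ext_getElem <;> simp [hg, Function.uncurry]

theorem dbar1_nonneg {S : Type*} {d : S → S → ℝ} (hd : ∀ x y, 0 ≤ d x y)
    (ξ η : Multiset S) : 0 ≤ dbar1 d ξ η := by
  unfold dbar1
  split_ifs
  · exact le_rfl
  · have : ((min ξ.card η.card : ℕ) : ℝ) ≤ ((max ξ.card η.card : ℕ) : ℝ) := by
      exact_mod_cast min_le_max
    have := matchCost_nonneg hd ξ η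
    apply div_nonneg _ (Nat.cast_nonneg _)
    linarith

theorem dbar1_of_card_eq {S : Type*} {d : S → S → ℝ} {n : ℕ} (hn : n ≠ 0) {ξ η : Multiset S}
    (hξ : ξ.card = n) (hη : η.card = n) : dbar1 d ξ η = matchCost d ξ η / n := by
  have : ¬(ξ = 0 ∧ η = 0) := by
    rintro ⟨rfl, -⟩
    exact hn (by simpa using hξ.symm)
  simp [dbar1, this, hξ, hη]

/-- The relative difference of the cardinalities is bounded by the distance. -/
theorem max_card_sub_min_card_le {S : Type*} {d : S → S → ℝ} (hd : ∀ x y, 0 ≤ d x y)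
    (ξ η : Multiset S) :
    ((max ξ.card η.card : ℕ) : ℝ) - ((min ξ.card η.card : ℕ) : ℝ) ≤
      dbar1 d ξ η * ((max ξ.card η.card : ℕ) : ℝ) := by
  unfold dbar1
  split_ifs with h
  · simp [h.1, h.2]
  · have hpos : 0 < max ξ.card η.card := by
      rw [lt_max_iff, Multiset.card_pos, Multiset.card_pos]
      tauto
    rw [div_mul_cancel₀ _ (by exact_mod_cast hpos.ne')]
    linarith [matchCost_nonneg hd ξ η]

/-- The cardinalities along a `d̄₁`-Cauchy sequence are eventually constant. -/
theorem exists_card_eq_of_dbar1_cauchy {S : Type*} {d : S → S → ℝ} (hd : ∀ x y, 0 ≤ d x y)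
    (u : ℕ → Multiset S)
    (hu : ∀ ε : ℝ, 0 < ε → ∃ K : ℕ, ∀ k ≥ K, ∀ l ≥ K, dbar1 d (u k) (u l) < ε) :
    ∃ n K : ℕ, ∀ k ≥ K, (u k).card = n := by
  obtain ⟨K, hK⟩ := hu (1 / 2) (by norm_num)
  set M := 2 * (u K).card with hM
  have hbound : ∀ k ≥ K, (u k).card ≤ M := by
    intro k hk
    by_contra! hlt
    have h1 := max_card_sub_min_card_le hd (u k) (u K)
    rw [max_eq_left (by omega), min_eq_right (by omega)] at h1
    have h2 := mul_le_mul_of_nonneg_right (hK k hk K le_rfl).le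
      (Nat.cast_nonneg (α := ℝ) (u k).card)
    have h3 : (2 * (u K).card : ℝ) < (u k).card := by exact_mod_cast hlt
    linarith
  obtain ⟨L, hL⟩ := hu (1 / (M + 1)) (by positivity)
  refine ⟨(u (max K L)).card, max K L, fun k hk => ?_⟩
  by_contra hne
  have h1 := max_card_sub_min_card_le hd (u k) (u (max K L))
  have h2 := mul_le_mul_of_nonneg_right
    (hL k (le_of_max_le_right hk) (max K L) (le_max_right _ _)).le
    (Nat.cast_nonneg (α := ℝ) (max (u k).card (u (max K L)).card))
  have h3 : ((min (u k).card (u (max K L)).card : ℕ) : ℝ) + 1 ≤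
      ((max (u k).card (u (max K L)).card : ℕ) : ℝ) := by
    exact_mod_cast min_lt_max.2 hne
  have h4 : ((max (u k).card (u (max K L)).card : ℕ) : ℝ) ≤ M := by
    exact_mod_cast max_le (hbound k (le_of_max_le_left hk)) (hbound _ (le_max_left _ _))
  have h5 : 1 / ((M : ℝ) + 1) * ((max (u k).card (u (max K L)).card : ℕ) : ℝ) < 1 := by
    rw [one_div_mul_eq_div, div_lt_one (by positivity)]
    linarith
  linarith

/-- The metric space `(𝔑, d̄₁)` is complete: every `d̄₁`-Cauchy sequence of finite
point measures converges in `d̄₁` to a finite point measure. -/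
theorem dbar1_complete {S : Type*} [MetricSpace S] [CompactSpace S]
    (hd : ∀ x y : S, dist x y ≤ 1) (u : ℕ → Multiset S)
    (hu : ∀ ε : ℝ, 0 < ε → ∃ K : ℕ, ∀ k ≥ K, ∀ l ≥ K, dbar1 dist (u k) (u l) < ε) :
    ∃ ξ : Multiset S, Tendsto (fun k => dbar1 dist (u k) ξ) atTop (nhds 0) := by
  have hdist : ∀ x y : S, 0 ≤ dist x y := fun _ _ => dist_nonneg
  obtain ⟨n, K, hcard⟩ := exists_card_eq_of_dbar1_cauchy hdist u hu
  rcases eq_or_ne n 0 with rfl | hn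
  · refine ⟨0, tendsto_const_nhds.congr' ?_⟩
    filter_upwards [eventually_ge_atTop K] with k hk
    simp [dbar1, Multiset.card_eq_zero.1 (hcard k hk)]
  have hn' : (0 : ℝ) < n := by positivity
  have henum : ∀ k, ∃ x : Fin n → S, (List.ofFn x : Multiset S) = u (k + K) := by
    intro k
    have hlen : (u (k + K)).toList.length = n := by
      rw [Multiset.length_toList, hcard _ (by omega)]
    refine ⟨fun i => (u (k + K)).toList.get (i.cast hlen.symm), ?_⟩
    conv_rhs => rw [← (u (k + K)).coe_toList]
    congr 1
    apply List.ext_getElem <;> simp [hlen]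
  choose x hx using henum
  obtain ⟨a, φ, hφ, hlim⟩ := CompactSpace.tendsto_subseq x
  refine ⟨(List.ofFn a : Multiset S), Metric.tendsto_atTop.2 fun ε hε => ?_⟩
  obtain ⟨L, hL⟩ := hu (ε / 2) (half_pos hε)
  obtain ⟨J, hJ⟩ := Metric.tendsto_atTop.1 hlim (ε / 2) (half_pos hε)
  refine ⟨max K L, fun k hk => ?_⟩
  have hkK : K ≤ k := le_of_max_le_left hk
  set j := max J L
  have hj : L ≤ φ j := (le_max_right J L).trans (hφ.id_le j)
  have h1 := hL k (le_of_max_le_right hk) (φ j + K) (by omega)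
  rw [dbar1_of_card_eq hn (hcard k hkK) (hcard _ (by omega)), ← hx, div_lt_iff₀ hn'] at h1
  obtain ⟨f, hf, hsum⟩ := exists_sum_lt_of_matchCost_lt (hcard k hkK) _ h1
  have h2 : ∑ i, dist (x (φ j) i) (a i) ≤ ε / 2 * n := by
    calc ∑ i, dist (x (φ j) i) (a i) ≤ ∑ _i : Fin n, ε / 2 :=
          Finset.sum_le_sum fun i _ =>
            (dist_le_pi_dist (x (φ j)) a i).trans (hJ j (le_max_left _ _)).le
      _ = ε / 2 * n := by simp [mul_comm]
  have h3 : ∑ i, dist (f i) (a i) ≤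
      ∑ i, dist (f i) (x (φ j) i) + ∑ i, dist (x (φ j) i) (a i) := by
    rw [← Finset.sum_add_distrib]
    exact Finset.sum_le_sum fun i _ => dist_triangle _ _ _
  have h4 := matchCost_ofFn_le hdist f a
  rw [Real.dist_0_eq_abs, abs_of_nonneg (dbar1_nonneg hdist _ _),
    dbar1_of_card_eq hn (hcard k hkK) (by simp), ← hf, div_lt_iff₀ hn']
  linarith
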